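/- For all positive integers n, m and every non-negative integer N, the polynomial ∏_{i=1}^{n} ∏_{a=1}^{m} (1 − x_i y_a) · Σ_λ s_λ(x_1,…,x_n) s_λ(y_1,…,y_m), where the sum runs over all partitions λ with |λ| ≤ N, ℓ(λ) ≤ n and ℓ(λ) ≤ m, has the same coefficient as the constant polynomial 1 on every monomial of total degree at most N (this is the Cauchy identity ∏_{i,a}(1 − x_i y_a)^{−1} = Σ_λ s_λ(x) s_λ(y), read off degree by degree). -/

import Mathlib

open MvPolynomial
open scoped Classical

/-- A partition: a weakly decreasing sequence of non-negative integers
with finitely many nonzero parts (indexed from 0). -/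
structure Partn where
  parts : ℕ → ℕ
  antitone : ∀ i j, i ≤ j → parts j ≤ parts i
  eventually_zero : ∃ N, ∀ i, N ≤ i → parts i = 0

namespace Partn

/-- The weight `|λ|` of a partition: the sum of its parts. -/
noncomputable def weight (p : Partn) : ℕ := ∑ᶠ i, p.parts i

/-- `ℓ(λ) ≤ n`: all parts from index `n` on vanish. -/
def LengthLE (p : Partn) (n : ℕ) : Prop := ∀ i, n ≤ i → p.parts i = 0

/-- The parts of the conjugate partition `λ'`:
`λ'_i` is the number of indices `j` with `λ_j > i`. -/
noncomputable def conjParts (p : Partn) (i : ℕ) : ℕ := Nat.card {j : ℕ // i < p.parts j}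

end Partn

/-- The alternant `det(x_i^{l_j + n - j})_{1 ≤ i,j ≤ n}` (indices taken 0-based). -/
noncomputable def alternant (n : ℕ) (l : ℕ → ℕ) : MvPolynomial (Fin n) ℤ :=
  (Matrix.of fun i j : Fin n =>
    (X i : MvPolynomial (Fin n) ℤ) ^ (l (j : ℕ) + (n - 1 - (j : ℕ)))).det

/-- The Vandermonde determinant `det(x_i^{n-j})_{1 ≤ i,j ≤ n}` (0-based). -/
noncomputable def vandermondeP (n : ℕ) : MvPolynomial (Fin n) ℤ :=
  (Matrix.of fun i j : Fin n =>
    (X i : MvPolynomial (Fin n) ℤ) ^ (n - 1 - (j : ℕ))).det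

/-- The Schur polynomial `s_l(x_1,…,x_n)`: the (unique, since `ℤ[x]` is a domain
and the Vandermonde determinant is nonzero) quotient of the alternant by the
Vandermonde determinant, when the latter divides the former. -/
noncomputable def schur (n : ℕ) (l : ℕ → ℕ) : MvPolynomial (Fin n) ℤ :=
  if h : ∃ q : MvPolynomial (Fin n) ℤ, q * vandermondeP n = alternant n l then h.choose else 0

/-- The Littlewood–Richardson coefficient `c^ν_{λμ}`: the coefficient of `s_ν` in the
Schur-basis expansion of `s_λ · s_μ` in `|λ| + |μ|` variables, extracted as the
coefficient of the dominant monomial `x^{ν+ρ}` in `s_λ · s_μ · (Vandermonde)`.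
It is zero unless `|ν| = |λ| + |μ|`. -/
noncomputable def lrCoeff (l m ν : Partn) : ℤ :=
  if ν.weight = l.weight + m.weight then
    MvPolynomial.coeff
      (Finsupp.equivFunOnFinite.symm fun j : Fin (l.weight + m.weight) =>
        ν.parts (j : ℕ) + (l.weight + m.weight - 1 - (j : ℕ)))
      (schur (l.weight + m.weight) l.parts * schur (l.weight + m.weight) m.parts *
        vandermondeP (l.weight + m.weight))
  else 0

theorem hom_mem_pow {σ : Type*} {V : MvPolynomial σ ℤ} {D : ℕ} (hV : V.IsHomogeneous D) :
    V ∈ idealOfVars σ ℤ ^ D := by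
  rw [mem_pow_idealOfVars_iff']
  intro x hx
  by_contra h
  exact h (hV.coeff_eq_zero (by omega))

theorem cancel_hom {σ : Type*} {V Q : MvPolynomial σ ℤ} {D M : ℕ} (hV : V.IsHomogeneous D)
    (h0 : V ≠ 0) (h : V * Q ∈ idealOfVars σ ℤ ^ (M + D)) : Q ∈ idealOfVars σ ℤ ^ M := by
  induction M with
  | zero => simp
  | succ M ih =>
    have hQ := ih (Ideal.pow_le_pow_right (by omega) h)
    have h1 : Q - homogeneousComponent M Q ∈ idealOfVars σ ℤ ^ (M + 1) := by
      rw [mem_pow_idealOfVars_iff'] at hQ ⊢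
      intro x hx
      rw [coeff_sub, coeff_homogeneousComponent]
      split_ifs with hh
      · simp
      · rw [hQ x (by omega)]; simp
    have h2 : V * homogeneousComponent M Q ∈ idealOfVars σ ℤ ^ (M + 1 + D) := by
      have : V * homogeneousComponent M Q = V * Q - V * (Q - homogeneousComponent M Q) := by ring
      rw [this]
      refine sub_mem h ?_
      rw [add_comm, pow_add]
      exact Ideal.mul_mem_mul (hom_mem_pow hV) h1
    have h3 := hV.mul (homogeneousComponent_isHomogeneous M Q)
    have h4 : V * homogeneousComponent M Q = 0 := by
      ext x
      rw [mem_pow_idealOfVars_iff'] at h2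
      by_cases hx : x.degree = D + M
      · rw [h2 x (by omega)]; simp
      · rw [h3.coeff_eq_zero hx]; simp
    rcases mul_eq_zero.1 h4 with h5 | h5
    · exact absurd h5 h0
    · simpa [h5] using h1

theorem det_mem_pow {R : Type*} [CommRing R] (I : Ideal R) {n : ℕ} (A : Matrix (Fin n) (Fin n) R)
    (e : Fin n → ℕ) (h : ∀ i j, A i j ∈ I ^ e j) : A.det ∈ I ^ (∑ j, e j) := by
  rw [Matrix.det_apply]
  refine sum_mem fun s _ => ?_
  rw [Units.smul_def]
  refine zsmul_mem ?_ _
  rw [← Finset.prod_pow_eq_pow_sum]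
  exact Ideal.prod_mem_prod fun i _ => h _ _

/-- Cauchy determinant in a commutative ring where the denominators are invertible. -/
theorem cauchy_det {A : Type*} [CommRing A] : ∀ (n : ℕ) (x y : Fin n → A)
    (u : Fin n → Fin n → A) (_ : ∀ i j, u i j * (1 - x i * y j) = 1),
    (Matrix.of u).det * ∏ i, ∏ j, (1 - x i * y j) =
      (∏ i : Fin n, ∏ j ∈ Finset.Ioi i, (x i - x j)) *
        ∏ i : Fin n, ∏ j ∈ Finset.Ioi i, (y i - y j) := by
  intro n
  induction n with
  | zero => intros; simp
  | succ n ih =>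
    intro x y u hu
    have key : (Matrix.of u).det = (∏ j, u 0 j) * (∏ i : Fin n, u i.succ 0) *
        (∏ i : Fin n, (x 0 - x i.succ)) * (∏ i : Fin n, (y 0 - y i.succ)) *
        (Matrix.of fun i j : Fin n => u i.succ j.succ).det := by
      have e1 : (Matrix.of u).det = (Matrix.of fun i j : Fin (n+1) => u 0 j *
          (Matrix.of fun i j : Fin (n+1) => (Fin.cons 1 (fun i : Fin n => x i.succ - x 0) : Fin (n+1) → A) i *
            (Matrix.of fun i j : Fin (n+1) => (Fin.cons 1 (fun i : Fin n => y j * u i.succ j) : Fin (n+1) → A) i) i j) i j).det := by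
        refine Matrix.det_eq_of_forall_row_eq_smul_add_const (Fin.cons 0 fun _ => 1) 0 (by simp) ?_
        intro i j
        refine Fin.cases ?_ (fun i => ?_) i
        · simp
        · have h1 := hu i.succ j
          have h2 := hu 0 j
          simp
          linear_combination u 0 j * h1 - u i.succ j * h2
      have e2 : (Matrix.of fun i j : Fin (n+1) => (Fin.cons 1 (fun i : Fin n => y j * u i.succ j) : Fin (n+1) → A) i).det
         = (Matrix.of fun i j : Fin (n+1) => (Fin.cons 1 (fun i : Fin n => y i.succ - y 0) : Fin (n+1) → A) j *
            (Matrix.of fun i j : Fin (n+1) => (Fin.cons 1 (fun i : Fin n => u i.succ 0) : Fin (n+1) → A) i *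
              (Matrix.of fun i j : Fin (n+1) => (Fin.cons (Fin.cons 1 (fun _ => 0) : Fin (n+1) → A) (fun i : Fin n => (Fin.cons (y 0) (fun j : Fin n => u i.succ j.succ) : Fin (n+1) → A)) : Fin (n+1) → Fin (n+1) → A) i j) i j) i j).det := by
        rw [← Matrix.det_transpose]
        conv_rhs => rw [← Matrix.det_transpose]
        refine Matrix.det_eq_of_forall_row_eq_smul_add_const (Fin.cons 0 fun _ => 1) 0 (by simp) ?_
        intro j i
        refine Fin.cases ?_ (fun i => ?_) i <;> refine Fin.cases ?_ (fun j => ?_) j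
        · simp
        · simp
        · simp [mul_comm]
        · have h1 := hu i.succ j.succ
          have h2 := hu i.succ 0
          simp
          linear_combination (y 0 * u i.succ 0) * h1 - y j.succ * u i.succ j.succ * h2
      rw [e1, Matrix.det_mul_row, Matrix.det_mul_column, e2, Matrix.det_mul_row,
        Matrix.det_mul_column, Matrix.det_succ_row_zero]
      rw [Finset.sum_eq_single 0 (by
        intro b _ hb
        obtain ⟨b, rfl⟩ := Fin.exists_succ_eq.2 hb
        simp) (by simp)]
      have e3 : (∏ i : Fin n, (x i.succ - x 0)) * (∏ i : Fin n, (y i.succ - y 0)) = 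
        (∏ i : Fin n, (x 0 - x i.succ)) * (∏ i : Fin n, (y 0 - y i.succ)) := by
        rw [← Finset.prod_mul_distrib, ← Finset.prod_mul_distrib]
        exact Finset.prod_congr rfl fun i _ => by ring
      have e4 : ((Matrix.of fun i j : Fin (n+1) => (Fin.cons (Fin.cons 1 (fun _ => 0) : Fin (n+1) → A) (fun i : Fin n => (Fin.cons (y 0) (fun j : Fin n => u i.succ j.succ) : Fin (n+1) → A)) : Fin (n+1) → Fin (n+1) → A) i j).submatrix Fin.succ (Fin.succAbove 0)) = (Matrix.of fun i j : Fin n => u i.succ j.succ) := by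
        ext i j; simp
      rw [e4]
      simp only [Fin.prod_univ_succ, Fin.cons_zero, Fin.cons_succ, Matrix.of_apply, Fin.val_zero]
      linear_combination ((u 0 0 * ∏ i : Fin n, u 0 i.succ) * (∏ i : Fin n, u i.succ 0) * (Matrix.of fun i j : Fin n => u i.succ j.succ).det) * e3
    have ih' := ih (fun i => x i.succ) (fun i => y i.succ) (fun i j => u i.succ j.succ)
      (fun i j => hu _ _)
    have f1 : (∏ j, u 0 j) * ∏ j, (1 - x 0 * y j) = 1 := by
      rw [← Finset.prod_mul_distrib]; exact Finset.prod_eq_one fun j _ => hu _ _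
    have f2 : (∏ i : Fin n, u i.succ 0) * ∏ i : Fin n, (1 - x i.succ * y 0) = 1 := by
      rw [← Finset.prod_mul_distrib]; exact Finset.prod_eq_one fun j _ => hu _ _
    have f3 : ∀ z : Fin (n+1) → A, (∏ i : Fin (n+1), ∏ j ∈ Finset.Ioi i, (z i - z j)) =
        (∏ i : Fin n, (z 0 - z i.succ)) * ∏ i : Fin n, ∏ j ∈ Finset.Ioi i, (z i.succ - z j.succ) := by
      intro z
      rw [Fin.prod_univ_succ]
      simp [Fin.prod_Ioi_succ]
    rw [f3, f3, key, Fin.prod_univ_succ (fun i => ∏ j, (1 - x i * y j))]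
    have f4 : (∏ i : Fin n, ∏ j, (1 - x i.succ * y j)) =
        (∏ i : Fin n, (1 - x i.succ * y 0)) * ∏ i : Fin n, ∏ j : Fin n, (1 - x i.succ * y j.succ) := by
      rw [← Finset.prod_mul_distrib]
      exact Finset.prod_congr rfl fun i _ => by rw [Fin.prod_univ_succ]
    rw [f4]
    generalize (∏ j, u 0 j) = a1 at *
    generalize (∏ j, (1 - x 0 * y j)) = a2 at *
    generalize (∏ i : Fin n, u i.succ 0) = a3 at *
    generalize (∏ i : Fin n, (1 - x i.succ * y 0)) = a4 at *
    generalize (∏ i : Fin n, (x 0 - x i.succ)) = a5 at *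
    generalize (∏ i : Fin n, (y 0 - y i.succ)) = a6 at *
    generalize (∏ i : Fin n, ∏ j : Fin n, (1 - x i.succ * y j.succ)) = a7 at *
    generalize (∏ i : Fin n, ∏ j ∈ Finset.Ioi i, (x i.succ - x j.succ)) = a8 at *
    generalize (∏ i : Fin n, ∏ j ∈ Finset.Ioi i, (y i.succ - y j.succ)) = a9 at *
    generalize (Matrix.of fun i j : Fin n => u i.succ j.succ).det = a10 at *
    calc _ = (a1 * a2) * (a3 * a4) * a5 * a6 * (a10 * a7) := by ring
      _ = _ := by rw [f1, f2, ih']; ring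

theorem vandermondeP_eq (n : ℕ) : vandermondeP n =
    ∏ i : Fin n, ∏ j ∈ Finset.Ioi i, ((X i : MvPolynomial (Fin n) ℤ) - X j) := by
  have h := Matrix.det_projVandermonde (1 : Fin n → MvPolynomial (Fin n) ℤ) X
  simp only [Pi.one_apply, one_mul] at h
  rw [← h, vandermondeP]
  congr 1
  ext1 i j
  rw [Matrix.projVandermonde_apply]
  simp only [Matrix.of_apply, Pi.one_apply, one_pow, one_mul, Fin.val_rev]
  congr 1
  omega

theorem vandermondeP_ne_zero (n : ℕ) : vandermondeP n ≠ 0 := by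
  rw [vandermondeP_eq]
  refine Finset.prod_ne_zero_iff.2 fun i _ => Finset.prod_ne_zero_iff.2 fun j hj => ?_
  rw [sub_ne_zero]
  intro h
  exact (Finset.mem_Ioi.1 hj).ne (X_injective h)

theorem vandermondeP_hom (n : ℕ) :
    (vandermondeP n).IsHomogeneous (∑ j : Fin n, (n - 1 - (j : ℕ))) := by
  rw [vandermondeP, Matrix.det_apply']
  refine IsHomogeneous.sum _ _ _ fun s _ => ?_
  rw [← map_intCast (C : ℤ →+* MvPolynomial (Fin n) ℤ)]
  refine IsHomogeneous.C_mul ?_ _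
  refine IsHomogeneous.prod _ _ _ fun i _ => ?_
  exact isHomogeneous_X_pow _ _

/-- A matrix of polynomial values is divisible by the Vandermonde determinant. -/
theorem vandermonde_dvd {R : Type*} [CommRing R] [Nontrivial R] {n : ℕ} (x : Fin n → R)
    (f : Fin n → Polynomial R) :
    (Matrix.vandermonde x).det ∣ (Matrix.of fun i j : Fin n => (f j).eval (x i)).det := by
  let q : Polynomial R := ∏ i, (Polynomial.X - Polynomial.C (x i))
  have hq : q.Monic := Polynomial.monic_prod_of_monic _ _ fun i _ => Polynomial.monic_X_sub_C _
  have hd : q.degree = n := by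
    rw [Polynomial.degree_eq_natDegree hq.ne_zero, Polynomial.natDegree_finsetProd_X_sub_C_eq_card]
    simp
  have h1 : (Matrix.of fun i j : Fin n => (f j).eval (x i)) =
      Matrix.vandermonde x * Matrix.of fun i j : Fin n => ((f j).modByMonic q).coeff i := by
    ext i j
    rw [Matrix.mul_apply]
    have h2 : (f j).eval (x i) = ((f j).modByMonic q).eval (x i) := by
      conv_lhs => rw [← Polynomial.modByMonic_add_div (f j) q]
      have : q.eval (x i) = 0 := by
        rw [Polynomial.eval_prod]
        exact Finset.prod_eq_zero (Finset.mem_univ i) (by simp)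
      simp [this]
    have h3 : ((f j).modByMonic q).natDegree < n := by
      have := Polynomial.degree_modByMonic_lt (f j) hq
      rw [hd] at this
      by_cases h0 : (f j).modByMonic q = 0
      · rw [h0]; simp; exact i.pos
      · rwa [Polynomial.degree_eq_natDegree h0, Nat.cast_lt] at this
    simp only [Matrix.of_apply, Matrix.vandermonde_apply]
    rw [h2, Polynomial.eval_eq_sum_range' h3, Finset.sum_range]
    exact Finset.sum_congr rfl fun k _ => mul_comm _ _
  rw [h1, Matrix.det_mul]
  exact dvd_mul_right _ _

theorem schur_spec (n : ℕ) (l : ℕ → ℕ) : schur n l * vandermondeP n = alternant n l := by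
  have h : ∃ q : MvPolynomial (Fin n) ℤ, q * vandermondeP n = alternant n l := by
    have h1 := vandermonde_dvd (X : Fin n → MvPolynomial (Fin n) ℤ)
      fun j => Polynomial.X ^ (l (j : ℕ) + (n - 1 - (j : ℕ)))
    have h2 : vandermondeP n ∣ (Matrix.vandermonde (X : Fin n → MvPolynomial (Fin n) ℤ)).det := by
      have : (Matrix.vandermonde (X : Fin n → MvPolynomial (Fin n) ℤ)).submatrix id Fin.revPerm =
          (Matrix.of fun i j : Fin n => (X i : MvPolynomial (Fin n) ℤ) ^ (n - 1 - (j : ℕ))) := by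
        ext1 i j
        simp only [Matrix.submatrix_apply, Matrix.vandermonde_apply, Matrix.of_apply, id,
          Fin.revPerm_apply, Fin.val_rev]
        congr 1
        omega
      rw [vandermondeP, ← this, Matrix.det_permute']
      rcases Int.units_eq_one_or (Equiv.Perm.sign (Fin.revPerm : Equiv.Perm (Fin n))) with h | h <;>
        simp [h]
    obtain ⟨q, hq⟩ := h2.trans h1
    refine ⟨q, ?_⟩
    rw [mul_comm, ← hq, alternant]
    simp
  rw [schur, dif_pos h]
  exact h.choose_spec

theorem strictMono_gap {n : ℕ} {h : Fin n → ℕ} (hh : StrictMono h) :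
    ∀ (d : ℕ) (a b : Fin n), (b : ℕ) = a + d → h a + d ≤ h b := by
  intro d
  induction d with
  | zero => intro a b hab; simp [Fin.ext (hab : (b : ℕ) = a)]
  | succ d ih =>
    intro a b hab
    have h1 := ih a ⟨a + d, by omega⟩ rfl
    have h2 : h ⟨a + d, by omega⟩ < h b := hh (by rw [Fin.lt_def]; simp; omega)
    omega

/-- The exponents of the alternant. -/
def gexp (n : ℕ) (p : Partn) (j : Fin n) : ℕ := p.parts j + (n - 1 - (j : ℕ))

theorem gexp_anti (n : ℕ) (p : Partn) : StrictAnti (gexp n p) := by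
  intro a b hab
  have := p.antitone a b (le_of_lt hab)
  have := b.2
  simp only [gexp]
  rw [Fin.lt_def] at hab
  omega

theorem Partn_ext {p q : Partn} (h : p.parts = q.parts) : p = q := by
  cases p; cases q; simp at h; subst h; rfl

theorem gexp_inj {n : ℕ} {p q : Partn} (hp : p.LengthLE n) (hq : q.LengthLE n)
    (h : gexp n p = gexp n q) : p = q := by
  apply Partn_ext
  ext i
  by_cases hi : i < n
  · have := congrFun h ⟨i, hi⟩
    simp only [gexp] at this
    omega
  · rw [hp i (by omega), hq i (by omega)]

theorem exists_partn {n B : ℕ} (f : Fin n → ℕ) (hf : Function.Injective f) (hB : ∀ i, f i < B + n) :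
    ∃ (p : Partn) (s : Equiv.Perm (Fin n)), (p.LengthLE n ∧ ∀ i, p.parts i ≤ B) ∧
      (fun i => gexp n p (s i)) = f := by
  let s := Tuple.sort f
  have hm : StrictMono (f ∘ s) :=
    (Tuple.monotone_sort f).strictMono_of_injective (hf.comp s.injective)
  have gap := strictMono_gap hm
  let h : ℕ → ℕ := fun k => if hk : k < n then (f ∘ s) ⟨k, hk⟩ else 0
  have gap' : ∀ a b, a ≤ b → b < n → h a + (b - a) ≤ h b := by
    intro a b hab hb
    have := gap (b - a) ⟨a, by omega⟩ ⟨b, hb⟩ (by simp; omega)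
    simp only [h, dif_pos hb, dif_pos (lt_of_le_of_lt hab hb)]
    exact this
  have hlt : ∀ a, a < n → h a < B + n := by
    intro a ha
    simp only [h, dif_pos ha]
    exact hB _
  refine ⟨⟨fun j => if j < n then h (n - 1 - j) - (n - 1 - j) else 0, ?_, n, ?_⟩,
    s.symm.trans Fin.revPerm, ⟨?_, ?_⟩, ?_⟩
  · intro i j hij
    by_cases hj : j < n
    · have := gap' (n - 1 - j) (n - 1 - i) (by omega) (by omega)
      simp only [if_pos hj, if_pos (lt_of_le_of_lt hij hj)]
      omega
    · simp [hj]
  · intro i hi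
    simp [not_lt.2 hi]
  · intro i hi
    simp [not_lt.2 hi]
  · intro i
    by_cases hi : i < n
    · have h1 := gap' (n - 1 - i) (n - 1) (by omega) (by omega)
      have h2 := hlt (n - 1) (by omega)
      simp only [if_pos hi]
      omega
    · simp [hi]
  · ext i
    obtain ⟨k, rfl⟩ := s.surjective i
    have h1 := gap' 0 k (by omega) k.2
    have h2 : h k = f (s k) := by simp [h]
    have hk := k.2
    simp only [gexp, Equiv.trans_apply, Equiv.symm_apply_apply, Fin.revPerm_apply, Fin.val_rev]
    rw [if_pos (by omega)]
    have h3 : n - 1 - (n - (↑k + 1)) = k := by omega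
    rw [h3]
    omega

theorem cauchy_binet {A : Type*} [CommRing A] (n B : ℕ) (x y : Fin n → A) (T : Finset Partn)
    (hT : ∀ p, p ∈ T ↔ p.LengthLE n ∧ ∀ i, p.parts i ≤ B) :
    ∑ p ∈ T, (Matrix.of fun i j => x i ^ gexp n p j).det * (Matrix.of fun i j => y i ^ gexp n p j).det
      = (Matrix.of fun i j => ∑ k ∈ Finset.range (B + n), (x i * y j) ^ k).det := by
  have e1 : (Matrix.of fun i j => ∑ k ∈ Finset.range (B + n), (x i * y j) ^ k).det =
      ∑ f ∈ Fintype.piFinset (fun _ : Fin n => Finset.range (B + n)),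
        (∏ i, x i ^ f i) * (Matrix.of fun i j => y j ^ f i).det := by
    have := (Matrix.detRowAlternating (n := Fin n) (R := A)).toMultilinearMap.map_sum_finset
      (fun i (k : ℕ) => fun j => (x i * y j) ^ k) (fun _ => Finset.range (B + n))
    have e : (fun i : Fin n => ∑ k ∈ Finset.range (B + n), fun j : Fin n => (x i * y j) ^ k) =
      (Matrix.of fun i j => ∑ k ∈ Finset.range (B + n), (x i * y j) ^ k) := by
      ext i j; simp
    rw [e] at this
    refine Eq.trans this (Finset.sum_congr rfl fun f _ => ?_)
    rw [← Matrix.det_mul_column]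
    simp only [mul_pow]
    rfl
  rw [e1]
  have e2 : ∀ p ∈ T, (Matrix.of fun i j => x i ^ gexp n p j).det *
      (Matrix.of fun i j => y i ^ gexp n p j).det =
      ∑ s : Equiv.Perm (Fin n), (∏ i, x i ^ gexp n p (s i)) *
        (Matrix.of fun i j => y j ^ gexp n p (s i)).det := by
    intro p _
    rw [← Matrix.det_transpose, Matrix.det_apply', Finset.sum_mul]
    refine Finset.sum_congr rfl fun s _ => ?_
    have h1 : (Matrix.of fun i j => y j ^ gexp n p (s i)) =
      (Matrix.of fun i j => y i ^ gexp n p j).transpose.submatrix s id := by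
      ext i j; simp
    rw [h1, Matrix.det_permute, Matrix.det_transpose]
    simp only [Matrix.transpose_apply, Matrix.of_apply]
    ring
  rw [Finset.sum_congr rfl e2, ← Finset.sum_product']
  refine Finset.sum_of_injOn (fun q : Partn × Equiv.Perm (Fin n) => fun i => gexp n q.1 (q.2 i))
    ?_ ?_ ?_ ?_
  · rintro ⟨p, s⟩ hp ⟨q, t⟩ hq h
    simp only [Finset.coe_product, Set.mem_prod, Finset.mem_coe, hT] at hp hq
    have h' : gexp n p ∘ s = gexp n q ∘ t := h
    have hr : Set.range (gexp n p) = Set.range (gexp n q) := by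
      rw [← s.surjective.range_comp (gexp n p), ← t.surjective.range_comp (gexp n q), h']
    have hg := ((gexp_anti n p).range_inj (gexp_anti n q)).1 hr
    have hpq := gexp_inj hp.1.1 hq.1.1 hg
    subst hpq
    congr 1
    ext i : 1
    exact (gexp_anti n p).injective (congrFun h' i)
  · rintro ⟨p, s⟩ hp
    simp only [Finset.coe_product, Set.mem_prod, Finset.mem_coe, hT] at hp
    simp only [Finset.mem_coe, Fintype.mem_piFinset, Finset.mem_range]
    intro i
    have := hp.1.2 (s i)
    have := (s i).2
    simp only [gexp]
    omega
  · intro f hf hn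
    have : ¬ Function.Injective f := by
      intro hi
      obtain ⟨p, s, h1, h2⟩ := exists_partn f hi (B := B) (by simpa using hf)
      exact hn ⟨(p, s), by simp [hT]; exact h1, h2⟩
    rw [Function.Injective] at this
    push Not at this
    obtain ⟨a, b, hab, hne⟩ := this
    rw [Matrix.det_zero_of_row_eq hne (by ext j; simp [hab]), mul_zero]
  · intro q _
    rfl

theorem weight_eq {n : ℕ} {p : Partn} (hp : p.LengthLE n) :
    p.weight = ∑ j : Fin n, p.parts j := by
  rw [Partn.weight, finsum_eq_sum_of_support_subset p.parts (s := Finset.range n),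
    Finset.sum_range]
  intro i hi
  by_contra h
  exact hi (hp i (by simpa using h))

theorem parts_le_weight {n : ℕ} {p : Partn} (hp : p.LengthLE n) (i : ℕ) :
    p.parts i ≤ p.weight := by
  by_cases hi : i < n
  · rw [weight_eq hp]
    exact Finset.single_le_sum (f := fun j : Fin n => p.parts j) (fun _ _ => Nat.zero_le _)
      (Finset.mem_univ ⟨i, hi⟩)
  · rw [hp i (by omega)]; exact Nat.zero_le _

theorem finite_box (n B : ℕ) : {p : Partn | p.LengthLE n ∧ ∀ i, p.parts i ≤ B}.Finite := by
  refine Set.Finite.of_injOn (f := fun p : Partn => fun i : Fin n => p.parts i)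
    (t := Set.pi Set.univ fun _ => Set.Iic B) ?_ ?_ (Set.Finite.pi fun _ => Set.finite_Iic B)
  · intro p hp i _
    exact hp.2 i
  · intro p hp q hq h
    refine gexp_inj hp.1 hq.1 ?_
    ext i
    have := congrFun h i
    simp only at this
    simp [gexp, this]

theorem finite_U (N n m : ℕ) :
    {p : Partn | p.weight ≤ N ∧ p.LengthLE n ∧ p.LengthLE m}.Finite :=
  (finite_box n N).subset fun _ hp => ⟨hp.2.1, fun i => (parts_le_weight hp.2.1 i).trans hp.1⟩

noncomputable def setU (N n m : ℕ) : Finset Partn := (finite_U N n m).toFinset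

theorem mem_setU {N n m : ℕ} {p : Partn} :
    p ∈ setU N n m ↔ p.weight ≤ N ∧ p.LengthLE n ∧ p.LengthLE m := by
  simp [setU]

noncomputable def boxP (n B : ℕ) : Finset Partn := (finite_box n B).toFinset

theorem mem_boxP {n B : ℕ} {p : Partn} :
    p ∈ boxP n B ↔ p.LengthLE n ∧ ∀ i, p.parts i ≤ B := by
  simp [boxP]

/-- The truncated Cauchy identity, as membership in a power of the ideal of the variables. -/
def Cau (n m N : ℕ) : Prop :=
  (∏ i : Fin n, ∏ a : Fin m,
      (1 - X (Sum.inl i) * X (Sum.inr a) : MvPolynomial (Fin n ⊕ Fin m) ℤ)) *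
    (∑ p ∈ setU N n m, rename Sum.inl (schur n p.parts) * rename Sum.inr (schur m p.parts)) - 1 ∈
      idealOfVars (Fin n ⊕ Fin m) ℤ ^ (N + 1)

theorem rename_alternant {σ : Type*} {n : ℕ} (f : Fin n → σ) (p : Partn) :
    rename f (alternant n p.parts) =
      (Matrix.of fun i j => (X (f i) : MvPolynomial σ ℤ) ^ gexp n p j).det := by
  rw [alternant, AlgHom.map_det]
  congr 1
  ext1 i j
  simp [gexp]

theorem rename_alternant_mem {σ : Type*} {n : ℕ} (f : Fin n → σ) {p : Partn} (hp : p.LengthLE n) :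
    rename f (alternant n p.parts) ∈
      idealOfVars σ ℤ ^ (p.weight + ∑ j : Fin n, (n - 1 - (j : ℕ))) := by
  rw [rename_alternant, weight_eq hp, ← Finset.sum_add_distrib]
  refine det_mem_pow _ _ _ fun i j => ?_
  exact Ideal.pow_mem_pow (Ideal.subset_span (Set.mem_range_self (f i))) _

theorem rename_vandermonde {σ : Type*} {n : ℕ} (f : Fin n → σ) :
    rename f (vandermondeP n) =
      ∏ i : Fin n, ∏ j ∈ Finset.Ioi i, ((X (f i) : MvPolynomial σ ℤ) - X (f j)) := by
  rw [vandermondeP_eq]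
  simp [map_prod]

theorem cau_square (n N : ℕ) : Cau n n N := by
  unfold Cau
  set D := ∑ j : Fin n, (n - 1 - (j : ℕ)) with hD
  set I := idealOfVars (Fin n ⊕ Fin n) ℤ with hI
  set P := (∏ i : Fin n, ∏ a : Fin n,
      (1 - X (Sum.inl i) * X (Sum.inr a) : MvPolynomial (Fin n ⊕ Fin n) ℤ)) with hP
  let Vx : MvPolynomial (Fin n ⊕ Fin n) ℤ := rename Sum.inl (vandermondeP n)
  let Vy : MvPolynomial (Fin n ⊕ Fin n) ℤ := rename Sum.inr (vandermondeP n)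
  have hV : (Vx * Vy).IsHomogeneous (D + D) :=
    ((vandermondeP_hom n).rename_isHomogeneous).mul ((vandermondeP_hom n).rename_isHomogeneous)
  have hV0 : Vx * Vy ≠ 0 := by
    refine mul_ne_zero ?_ ?_
    · exact fun h => vandermondeP_ne_zero n
        (rename_injective _ Sum.inl_injective (by rw [map_zero]; exact h))
    · exact fun h => vandermondeP_ne_zero n
        (rename_injective _ Sum.inr_injective (by rw [map_zero]; exact h))
  refine cancel_hom hV hV0 ?_
  let M := N + 1 + (D + D)
  change _ ∈ I ^ M
  let aa : Partn → MvPolynomial (Fin n ⊕ Fin n) ℤ := fun p =>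
    rename Sum.inl (alternant n p.parts) * rename Sum.inr (alternant n p.parts)
  have c1 : P * (∑ p ∈ boxP n M, aa p) - Vx * Vy ∈ I ^ M := by
    have h1 := cauchy_binet n M (fun i => (X (Sum.inl i) : MvPolynomial (Fin n ⊕ Fin n) ℤ))
      (fun i => X (Sum.inr i)) (boxP n M) (fun p => mem_boxP)
    simp only [← rename_alternant] at h1
    rw [show (∑ p ∈ boxP n M, aa p) = _ from h1]
    rw [← Ideal.Quotient.eq]
    have h2 := cauchy_det n (fun i => Ideal.Quotient.mk (I ^ M) (X (Sum.inl i)))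
      (fun i => Ideal.Quotient.mk (I ^ M) (X (Sum.inr i)))
      (fun i j => Ideal.Quotient.mk (I ^ M)
        (∑ k ∈ Finset.range (M + n), (X (Sum.inl i) * X (Sum.inr j)) ^ k)) (by
        intro i j
        rw [← map_mul, ← map_one (Ideal.Quotient.mk (I ^ M)), ← map_sub, ← map_mul,
          geom_sum_mul_neg, Ideal.Quotient.eq]
        rw [sub_sub_cancel_left, neg_mem_iff]
        refine Ideal.pow_le_pow_right (Nat.le_add_right M n) (Ideal.pow_mem_pow ?_ _)
        exact Ideal.mul_mem_left _ _ (Ideal.subset_span ⟨_, rfl⟩))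
    rw [mul_comm P, map_mul, map_mul, RingHom.map_det]
    simp only [Vx, Vy, rename_vandermonde, hP, map_prod, map_sub, map_mul, map_one]
    rw [← h2]
    rfl
  have c2 : ∑ p ∈ boxP n M, aa p - ∑ p ∈ setU N n n, aa p ∈ I ^ M := by
    have hsub : setU N n n ⊆ boxP n M := by
      intro p hp
      rw [mem_setU] at hp
      rw [mem_boxP]
      refine ⟨hp.2.1, fun i => (parts_le_weight hp.2.1 i).trans ?_⟩
      have := hp.1
      simp only [M]
      omega
    rw [← Finset.sum_sdiff hsub, add_sub_cancel_right]
    refine sum_mem fun p hp => ?_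
    rw [Finset.mem_sdiff, mem_setU, mem_boxP] at hp
    have hw : N < p.weight := by
      by_contra h
      exact hp.2 ⟨by omega, hp.1.1, hp.1.1⟩
    have h1 := Ideal.mul_mem_mul (rename_alternant_mem (Sum.inl : Fin n → Fin n ⊕ Fin n) hp.1.1)
      (rename_alternant_mem (Sum.inr : Fin n → Fin n ⊕ Fin n) hp.1.1)
    rw [← pow_add] at h1
    exact Ideal.pow_le_pow_right (by simp only [M]; omega) h1
  have c3 : Vx * Vy * (P * (∑ p ∈ setU N n n,
      rename Sum.inl (schur n p.parts) * rename Sum.inr (schur n p.parts)) - 1) =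
      (P * (∑ p ∈ boxP n M, aa p) - Vx * Vy) -
        P * (∑ p ∈ boxP n M, aa p - ∑ p ∈ setU N n n, aa p) := by
    have : ∑ p ∈ setU N n n, aa p = (∑ p ∈ setU N n n,
      rename Sum.inl (schur n p.parts) * rename Sum.inr (schur n p.parts)) * (Vx * Vy) := by
      rw [Finset.sum_mul]
      refine Finset.sum_congr rfl fun p _ => ?_
      simp only [aa, ← schur_spec, map_mul, Vx, Vy]
      ring
    rw [this]
    ring
  rw [c3]
  exact sub_mem c1 (Ideal.mul_mem_left _ _ c2)

theorem map_mem_pow {σ τ : Type*} (φ : MvPolynomial σ ℤ →ₐ[ℤ] MvPolynomial τ ℤ)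
    (h : ∀ s, φ (X s) ∈ idealOfVars τ ℤ) (k : ℕ) {q : MvPolynomial σ ℤ}
    (hq : q ∈ idealOfVars σ ℤ ^ k) : φ q ∈ idealOfVars τ ℤ ^ k := by
  have h1 : (idealOfVars σ ℤ).map φ ≤ idealOfVars τ ℤ := by
    rw [idealOfVars, Ideal.map_span, Ideal.span_le]
    rintro _ ⟨_, ⟨s, rfl⟩, rfl⟩
    exact h s
  have h2 := Ideal.mem_map_of_mem φ hq
  rw [Ideal.map_pow] at h2
  exact Ideal.pow_right_mono h1 k h2

theorem cau_swap {n m N : ℕ} (h : Cau n m N) : Cau m n N := by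
  unfold Cau at h ⊢
  have h1 := map_mem_pow (rename Sum.swap) (fun s => by
    rw [rename_X]; exact Ideal.subset_span ⟨_, rfl⟩) _ h
  have hU : setU N m n = setU N n m := by
    ext p; rw [mem_setU, mem_setU]; tauto
  rw [hU]
  convert h1 using 1
  simp only [map_sub, map_mul, map_prod, map_sum, map_one, rename_X, rename_rename, Sum.swap_inl,
    Sum.swap_inr]
  rw [Finset.prod_comm]
  congr 2
  · simp only [mul_comm]
  · refine Finset.sum_congr rfl fun p _ => ?_
    rw [mul_comm]
    rfl

/-- Set the last variable to zero. -/
noncomputable def killLast (n : ℕ) : MvPolynomial (Fin (n + 1)) ℤ →ₐ[ℤ] MvPolynomial (Fin n) ℤ :=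
  aeval (Fin.lastCases 0 X)

theorem kill_alternant (n : ℕ) (l : ℕ → ℕ) : killLast n (alternant (n + 1) l) =
    if l n = 0 then (∏ i : Fin n, X i) * alternant n l else 0 := by
  rw [alternant, AlgHom.map_det, Matrix.det_succ_row _ (Fin.last n)]
  rw [Finset.sum_eq_single (Fin.last n)]
  · rw [alternant, ← Matrix.det_mul_column]
    split_ifs with h
    · have e : ((killLast n).mapMatrix (Matrix.of fun i j : Fin (n + 1) =>
          (X i : MvPolynomial (Fin (n + 1)) ℤ) ^ (l (j : ℕ) + (n + 1 - 1 - (j : ℕ))))).submatrix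
          (Fin.last n).succAbove (Fin.last n).succAbove =
          Matrix.of fun i j : Fin n => X i * (Matrix.of fun i j : Fin n =>
    (X i : MvPolynomial (Fin n) ℤ) ^ (l (j : ℕ) + (n - 1 - (j : ℕ)))) i j := by
        ext1 i j
        have hj := j.2
        simp only [Matrix.submatrix_apply, AlgHom.mapMatrix_apply, Matrix.map_apply,
          Matrix.of_apply, Fin.succAbove_last, map_pow, killLast, aeval_X, Fin.lastCases_castSucc,
          Fin.val_castSucc]
        rw [← pow_succ']
        congr 1
        omega
      rw [e]
      simp [killLast, h]
    · simp [killLast, h]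
  · intro b _ hb
    have : (b : ℕ) < n := Fin.val_lt_last hb
    simp only [AlgHom.mapMatrix_apply, Matrix.map_apply, Matrix.of_apply, map_pow, killLast,
      aeval_X, Fin.lastCases_last]
    rw [zero_pow (by omega)]
    simp
  · simp

theorem kill_vandermonde (n : ℕ) : killLast n (vandermondeP (n + 1)) =
    (∏ i : Fin n, X i) * vandermondeP n := by
  have h : ∀ k, vandermondeP k = alternant k (fun _ => 0) := by
    intro k; simp [vandermondeP, alternant]
  rw [h, h, kill_alternant]
  simp

theorem kill_schur (n : ℕ) (l : ℕ → ℕ) : killLast n (schur (n + 1) l) =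
    if l n = 0 then schur n l else 0 := by
  have h := congrArg (killLast n) (schur_spec (n + 1) l)
  rw [map_mul, kill_vandermonde, kill_alternant] at h
  have h0 : (∏ i : Fin n, (X i : MvPolynomial (Fin n) ℤ)) * vandermondeP n ≠ 0 :=
    mul_ne_zero (Finset.prod_ne_zero_iff.2 fun i _ => X_ne_zero i) (vandermondeP_ne_zero n)
  refine mul_right_cancel₀ h0 ?_
  rw [h]
  split_ifs
  · rw [← schur_spec]; ring
  · simp

theorem cau_step {n m N : ℕ} (h : Cau (n + 1) m N) : Cau n m N := by
  unfold Cau at h ⊢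
  let φ : MvPolynomial (Fin (n + 1) ⊕ Fin m) ℤ →ₐ[ℤ] MvPolynomial (Fin n ⊕ Fin m) ℤ :=
    aeval (Sum.elim (Fin.lastCases 0 fun i => X (Sum.inl i)) fun a => X (Sum.inr a))
  have h1 := map_mem_pow φ (fun s => by
    rcases s with i | a
    · refine Fin.lastCases ?_ (fun i => ?_) i
      · simp [φ]
      · simp only [φ, aeval_X, Sum.elim_inl, Fin.lastCases_castSucc]
        exact Ideal.subset_span ⟨_, rfl⟩
    · simp only [φ, aeval_X, Sum.elim_inr]
      exact Ideal.subset_span ⟨_, rfl⟩) _ h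
  have hr : ∀ q, φ (rename Sum.inr q) = rename Sum.inr q := by
    intro q
    rw [← AlgHom.comp_apply]
    congr 1
    ext i : 1
    simp [φ]
  have hl : ∀ q, φ (rename Sum.inl q) = rename Sum.inl (killLast n q) := by
    intro q
    rw [← AlgHom.comp_apply, ← AlgHom.comp_apply]
    congr 1
    ext i : 1
    refine Fin.lastCases ?_ (fun i => ?_) i <;> simp [φ, killLast]
  convert h1 using 1
  simp only [map_sub, map_mul, map_prod, map_sum, map_one, hr, hl, kill_schur]
  congr 2
  · rw [Fin.prod_univ_castSucc]
    simp [φ]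
  · have hsub : setU N n m ⊆ setU N (n + 1) m := by
      intro p hp
      rw [mem_setU] at hp ⊢
      exact ⟨hp.1, fun i hi => hp.2.1 i (by omega), hp.2.2⟩
    rw [← Finset.sum_subset hsub]
    · refine Finset.sum_congr rfl fun p hp => ?_
      rw [mem_setU] at hp
      rw [if_pos (hp.2.1 n le_rfl)]
    · intro p hp hnp
      rw [if_neg, map_zero, zero_mul]
      intro h0
      rw [mem_setU] at hp hnp
      refine hnp ⟨hp.1, fun i hi => ?_, hp.2.2⟩
      rcases Nat.eq_or_lt_of_le hi with rfl | hi
      · exact h0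
      · exact hp.2.1 i hi

theorem cau_add {n m N : ℕ} (r : ℕ) (h : Cau (n + r) m N) : Cau n m N := by
  induction r with
  | zero => exact h
  | succ r ih => exact ih (cau_step h)

theorem cau_all (n m N : ℕ) : Cau n m N := by
  refine cau_add m (cau_swap (cau_add n (cau_swap ?_)))
  rw [add_comm m n]
  exact cau_square _ _

theorem cauchy (n m : ℕ) (hn : 0 < n) (hm : 0 < m) (N : ℕ) :
    ∀ d : (Fin n ⊕ Fin m) →₀ ℕ, (d.sum fun _ e => e) ≤ N →
      MvPolynomial.coeff d
        ((∏ i : Fin n, ∏ a : Fin m,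
            (1 - X (Sum.inl i) * X (Sum.inr a) : MvPolynomial (Fin n ⊕ Fin m) ℤ)) *
          ∑ᶠ (p : Partn) (_ : p.weight ≤ N ∧ p.LengthLE n ∧ p.LengthLE m),
            rename Sum.inl (schur n p.parts) * rename Sum.inr (schur m p.parts)) =
      MvPolynomial.coeff d (1 : MvPolynomial (Fin n ⊕ Fin m) ℤ) := by
  intro d hd
  have h := cau_all n m N
  unfold Cau at h
  rw [mem_pow_idealOfVars_iff'] at h
  have h1 := h d (Nat.lt_succ_of_le hd)
  rw [coeff_sub, sub_eq_zero] at h1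
  rw [← h1]
  congr 2
  exact finsum_mem_eq_finite_toFinset_sum _ (finite_U N n m)
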